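/- Let Λ be an artin algebra and M an indecomposable finite length Λ-module which is a brick. Let Y be a module with a homogeneous M-filtration M = M[1] ⊂ M[2] ⊂ ⋯ ⊂ M[m] = Y, assume this is the only M-filtration of Y, and assume m ≥ 2. Then Y has precisely one Gabriel-Roiter submodule, namely M[m−1]. -/

import Mathlib

/-!
Setting: `k` is a commutative artinian ring and `Λ` an artin `k`-algebra
(an algebra over `k` which is finitely generated as a `k`-module).
All modules considered are `Λ`-modules of finite length (`IsFiniteLength Λ M`),
and `|M|` denotes the length of `M`, implemented as the height
`Order.height (⊤ : Submodule Λ M)` of the lattice of submodules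
(for a submodule `N` of an ambient module, its length is `Order.height N`).
-/

universe u v

open Submodule

section GRDefs

variable (Λ : Type u) [Ring Λ]

/-- A submodule `N` of an ambient module is indecomposable (as a module):
it is nonzero, and whenever it is the direct sum of two submodules, one of them is zero. -/
def IndecSub {Y : Type v} [AddCommGroup Y] [Module Λ Y] (N : Submodule Λ Y) : Prop :=
  N ≠ ⊥ ∧ ∀ A B : Submodule Λ Y, A ≤ N → B ≤ N → A ⊔ B = N → A ⊓ B = ⊥ → A = ⊥ ∨ B = ⊥

/-- A module is indecomposable iff its top submodule is. -/
def IndecMod (M : Type v) [AddCommGroup M] [Module Λ M] : Prop :=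
  IndecSub Λ (⊤ : Submodule Λ M)

/-- The length `|M|` of a module, as an extended natural number. -/
noncomputable def modLen (M : Type v) [AddCommGroup M] [Module Λ M] : ℕ∞ :=
  Order.height (⊤ : Submodule Λ M)

/-- The length `|N|` of a submodule of an ambient module, as a natural number. -/
noncomputable def subLen {Y : Type v} [AddCommGroup Y] [Module Λ Y] (N : Submodule Λ Y) : ℕ :=
  (Order.height N).toNat

open Classical in
/-- Fuel-based auxiliary function for the Gabriel-Roiter measure. -/
noncomputable def muAux {Y : Type v} [AddCommGroup Y] [Module Λ Y] :
    ℕ → Submodule Λ Y → ℝ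
  | 0, _ => 0
  | n + 1, N =>
      (if IndecSub Λ N then (2 : ℝ) ^ (-(subLen Λ N : ℤ)) else 0)
        + sSup (muAux n '' {N' : Submodule Λ Y | N' < N})

/-- The Gabriel-Roiter measure `μ(N)` of a submodule `N` of an ambient module:
`μ(0) = 0`; if `N ≠ 0` is decomposable, `μ(N)` is the maximum of `μ(N')` over proper
submodules `N'` of `N`; if `N` is indecomposable, `μ(N) = 2^(-|N|)` plus this maximum.
(For modules of finite length the supremum is a maximum and the fuel `|N|` suffices for
the recursion, so this agrees with the usual inductive definition; the measure of a
submodule depends only on the sublattice of its submodules, hence it does not matter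
in which ambient module it is computed.) -/
noncomputable def mu {Y : Type v} [AddCommGroup Y] [Module Λ Y] (N : Submodule Λ Y) : ℝ :=
  muAux Λ (subLen Λ N) N

/-- The Gabriel-Roiter measure of a module. -/
noncomputable def muMod (M : Type v) [AddCommGroup M] [Module Λ M] : ℝ :=
  mu Λ (⊤ : Submodule Λ M)

/-- `X` is a Gabriel-Roiter submodule of the (indecomposable, non-simple) ambient
module `Y`: `X` is an indecomposable proper submodule with `μ(Y) = μ(X) + 2^(-|Y|)`. -/
def IsGRSub {Y : Type v} [AddCommGroup Y] [Module Λ Y] (X : Submodule Λ Y) : Prop :=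
  IndecMod Λ Y ∧ IndecSub Λ X ∧ X ≠ ⊤ ∧
    mu Λ (⊤ : Submodule Λ Y) = mu Λ X + (2 : ℝ) ^ (-(subLen Λ (⊤ : Submodule Λ Y) : ℤ))

/-- A map `u : X → Y` is a Gabriel-Roiter inclusion iff it is injective and its
image is a Gabriel-Roiter submodule of `Y`. -/
def IsGRInclusion {X Y : Type v} [AddCommGroup X] [Module Λ X] [AddCommGroup Y] [Module Λ Y]
    (u : X →ₗ[Λ] Y) : Prop :=
  Function.Injective u ∧ IsGRSub Λ (LinearMap.range u)

/-- A linear map is a split monomorphism. -/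
def IsSplitMonoHom {A B : Type v} [AddCommGroup A] [Module Λ A] [AddCommGroup B] [Module Λ B]
    (f : A →ₗ[Λ] B) : Prop :=
  ∃ g : B →ₗ[Λ] A, g.comp f = LinearMap.id

/-- A linear map is a split epimorphism. -/
def IsSplitEpiHom {A B : Type v} [AddCommGroup A] [Module Λ A] [AddCommGroup B] [Module Λ B]
    (f : A →ₗ[Λ] B) : Prop :=
  ∃ g : B →ₗ[Λ] A, f.comp g = LinearMap.id

/-- A morphism `f` in the category of finite length `Λ`-modules is irreducible if it is
neither a split monomorphism nor a split epimorphism and, whenever `f = g ∘ h` with the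
intermediate module of finite length, either `h` is a split monomorphism or `g` is a
split epimorphism. -/
def IsIrreducibleHom {A B : Type v} [AddCommGroup A] [Module Λ A] [AddCommGroup B] [Module Λ B]
    (f : A →ₗ[Λ] B) : Prop :=
  ¬ IsSplitMonoHom Λ f ∧ ¬ IsSplitEpiHom Λ f ∧
    ∀ (Z : Type v) [AddCommGroup Z] [Module Λ Z], IsFiniteLength Λ Z →
      ∀ (h : A →ₗ[Λ] Z) (g : Z →ₗ[Λ] B), f = g.comp h →
        IsSplitMonoHom Λ h ∨ IsSplitEpiHom Λ g

/-- An indecomposable submodule `U` of the ambient module is piling provided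
`μ(V) ≤ μ(U)` for every indecomposable submodule `V` with `|V| ≤ |U|`. -/
def IsPilingSub {Y : Type v} [AddCommGroup Y] [Module Λ Y] (U : Submodule Λ Y) : Prop :=
  IndecSub Λ U ∧ ∀ V : Submodule Λ Y, IndecSub Λ V →
    Order.height V ≤ Order.height U → mu Λ V ≤ mu Λ U

/-- A Gabriel-Roiter filtration `c 0 ⊂ c 1 ⊂ ⋯ ⊂ c t = N` of an (indecomposable)
submodule `N`: a chain of indecomposable submodules starting at a simple module such
that each inclusion `c i ⊂ c (i+1)` is a Gabriel-Roiter inclusion,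
i.e. `μ(c (i+1)) = μ(c i) + 2^(-|c (i+1)|)`. -/
def IsGRFiltration {Y : Type v} [AddCommGroup Y] [Module Λ Y] {t : ℕ}
    (c : Fin (t + 1) → Submodule Λ Y) (N : Submodule Λ Y) : Prop :=
  c (Fin.last t) = N ∧
  IsSimpleModule Λ (c 0) ∧
  (∀ i : Fin (t + 1), IndecSub Λ (c i)) ∧
  ∀ i : Fin t, c i.castSucc < c i.succ ∧
    mu Λ (c i.succ) = mu Λ (c i.castSucc) + (2 : ℝ) ^ (-(subLen Λ (c i.succ) : ℤ))

/-- A brick: a nonzero module all of whose nonzero endomorphisms are invertible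
(i.e. the endomorphism ring is a division ring). -/
def IsBrick (M : Type v) [AddCommGroup M] [Module Λ M] : Prop :=
  (∃ x : M, x ≠ 0) ∧ ∀ f : M →ₗ[Λ] M, f ≠ 0 → Function.Bijective f

/-- An `M`-filtration `0 = c 0 ⊂ c 1 ⊂ ⋯ ⊂ c m = Y` of the module `Y`
(so `c j` is the module `M[j]`, with `M[0] = 0`, and the `M`-length of `Y` is `m`):
all consecutive factors `c (i+1) / c i` are isomorphic to `M`. -/
structure IsMFiltration (M : Type v) [AddCommGroup M] [Module Λ M]
    {Y : Type v} [AddCommGroup Y] [Module Λ Y] {m : ℕ}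
    (c : Fin (m + 1) → Submodule Λ Y) : Prop where
  bot : c 0 = ⊥
  top : c (Fin.last m) = ⊤
  lt : ∀ i : Fin m, c i.castSucc < c i.succ
  quot : ∀ i : Fin m,
    Nonempty ((↥(c i.succ) ⧸ comap (c i.succ).subtype (c i.castSucc)) ≃ₗ[Λ] M)

/-- A homogeneous `M`-filtration: an `M`-filtration in which moreover all the
`M[i] = c i` with `i ≥ 1` are indecomposable and all the inclusions
`M[i-1] ⊂ M[i]` for `2 ≤ i ≤ m` are irreducible monomorphisms. -/
structure IsHomogMFiltration (M : Type v) [AddCommGroup M] [Module Λ M]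
    {Y : Type v} [AddCommGroup Y] [Module Λ Y] {m : ℕ}
    (c : Fin (m + 1) → Submodule Λ Y) extends IsMFiltration Λ M c : Prop where
  indec : ∀ i : Fin (m + 1), i ≠ 0 → IndecSub Λ (c i)
  irr : ∀ i : Fin m, (i : ℕ) ≠ 0 →
    IsIrreducibleHom Λ (Submodule.inclusion (toIsMFiltration.lt i).le)

end GRDefs

section Measure

variable {Λ : Type u} [Ring Λ]
variable {Y : Type v} [AddCommGroup Y] [Module Λ Y]

section Length

lemma subLen_eq_length (N : Submodule Λ Y) : subLen Λ N = (Module.length Λ N).toNat := by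
  rw [subLen, Module.length_submodule]

lemma LinearEquiv.subLen_eq {A B : Type v} [AddCommGroup A] [Module Λ A] [AddCommGroup B]
    [Module Λ B] {P : Submodule Λ A} {Q : Submodule Λ B} (e : P ≃ₗ[Λ] Q) :
    subLen Λ P = subLen Λ Q := by
  rw [subLen_eq_length, subLen_eq_length, e.length_eq]

lemma subLen_bot : subLen Λ (⊥ : Submodule Λ Y) = 0 := by
  simp [subLen]

variable [IsNoetherian Λ Y] [IsArtinian Λ Y]

lemma coe_subLen (N : Submodule Λ Y) : (subLen Λ N : ℕ∞) = Order.height N :=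
  ENat.natCast_toNat N.height_lt_top.ne

lemma subLen_strictMono : StrictMono (subLen Λ (Y := Y)) := fun A B h => by
  have := Submodule.height_strictMono h
  rw [← coe_subLen, ← coe_subLen] at this
  exact_mod_cast this

lemma subLen_mono : Monotone (subLen Λ (Y := Y)) := subLen_strictMono.monotone

lemma eq_of_le_of_subLen_le {A B : Submodule Λ Y} (h : A ≤ B)
    (hl : subLen Λ B ≤ subLen Λ A) : A = B := by
  by_contra hne
  exact absurd (subLen_strictMono (lt_of_le_of_ne h hne)) (by omega)

lemma subLen_pos {N : Submodule Λ Y} (h : N ≠ ⊥) : 0 < subLen Λ N := by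
  have := subLen_strictMono (bot_lt_iff_ne_bot.2 h)
  omega

lemma subLen_map_add {A : Type v} [AddCommGroup A] [Module Λ A] (f : Y →ₗ[Λ] A)
    (N : Submodule Λ Y) :
    subLen Λ N = subLen Λ (N ⊓ LinearMap.ker f) + subLen Λ (N.map f) := by
  have hex : Function.Exact
      (Submodule.inclusion (inf_le_left : N ⊓ LinearMap.ker f ≤ N)) (f.submoduleMap N) := by
    rw [LinearMap.exact_iff]
    ext ⟨x, hx⟩
    simp [Submodule.range_inclusion, Subtype.ext_iff]
  have h := Module.length_eq_add_of_exact _ _ (Submodule.inclusion_injective _)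
    (f.submoduleMap_surjective N) hex
  have : IsNoetherian Λ (N.map f) := isNoetherian_of_surjective _
    (LinearMap.range_eq_top.2 (f.submoduleMap_surjective N))
  have : IsArtinian Λ (N.map f) := isArtinian_of_surjective N _ (f.submoduleMap_surjective N)
  rw [subLen_eq_length, subLen_eq_length, subLen_eq_length, h,
    ENat.toNat_add Module.length_ne_top Module.length_ne_top]

end Length

lemma indecSub_map_iff {A : Type v} [AddCommGroup A] [Module Λ A] {f : Y →ₗ[Λ] A}
    (hf : Function.Injective f) (N : Submodule Λ Y) :
    IndecSub Λ (N.map f) ↔ IndecSub Λ N := by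
  have hinj := Submodule.map_injective_of_injective hf
  have hbot : ∀ P : Submodule Λ Y, P.map f = ⊥ ↔ P = ⊥ := fun P => by
    rw [← Submodule.map_bot f, hinj.eq_iff]
  unfold IndecSub
  rw [Ne, hbot]
  refine and_congr_right fun _ => ⟨fun h P Q hP hQ hs hi => ?_, fun h P Q hP hQ hs hi => ?_⟩
  · have := h (P.map f) (Q.map f) (Submodule.map_mono hP) (Submodule.map_mono hQ)
      (by rw [← Submodule.map_sup, hs]) (by rw [← Submodule.map_inf f hf, hi, Submodule.map_bot])
    rwa [hbot, hbot] at this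
  · obtain ⟨P, rfl⟩ : ∃ P' : Submodule Λ Y, P'.map f = P :=
      ⟨P.comap f, Submodule.map_comap_eq_self (hP.trans (LinearMap.map_le_range))⟩
    obtain ⟨Q, rfl⟩ : ∃ Q' : Submodule Λ Y, Q'.map f = Q :=
      ⟨Q.comap f, Submodule.map_comap_eq_self (hQ.trans (LinearMap.map_le_range))⟩
    rw [hbot, hbot]
    rw [Submodule.map_le_map_iff_of_injective hf] at hP hQ
    rw [← Submodule.map_sup, hinj.eq_iff] at hs
    rw [← Submodule.map_inf f hf, hbot] at hi
    exact h P Q hP hQ hs hi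

/-- A linear map that is injective on `N` identifies `N` with its image. -/
noncomputable def equivMapOfDisjoint {A : Type v} [AddCommGroup A] [Module Λ A]
    (f : Y →ₗ[Λ] A) (N : Submodule Λ Y) (h : N ⊓ LinearMap.ker f = ⊥) : N ≃ₗ[Λ] N.map f :=
  LinearEquiv.ofBijective (f.submoduleMap N) ⟨by
    rw [← LinearMap.ker_eq_bot, eq_bot_iff]
    rintro ⟨x, hx⟩ hfx
    have : x ∈ N ⊓ LinearMap.ker f := ⟨hx, by simpa [Subtype.ext_iff] using hfx⟩
    rw [h] at this
    simpa using this, f.submoduleMap_surjective N⟩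

lemma mu_bot : mu Λ (⊥ : Submodule Λ Y) = 0 := by
  simp [mu, subLen_bot, muAux]

section Recursion

variable [IsNoetherian Λ Y] [IsArtinian Λ Y]

lemma muAux_eq_of_le {n n' : ℕ} {N : Submodule Λ Y} (hn : subLen Λ N ≤ n)
    (hn' : subLen Λ N ≤ n') : muAux Λ n N = muAux Λ n' N := by
  induction n generalizing n' N with
  | zero =>
    have hN : N = ⊥ := by
      by_contra h
      have := subLen_pos h
      omega
    subst hN
    cases n' with
    | zero => rfl
    | succ n' => simp [muAux, IndecSub]
  | succ n ih =>
    cases n' with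
    | zero =>
      have hN : N = ⊥ := by
        by_contra h
        have := subLen_pos h
        omega
      subst hN
      simp [muAux, IndecSub]
    | succ n' =>
      rw [muAux, muAux]
      congr 2
      refine Set.image_congr fun P hP => ?_
      have := subLen_strictMono (show P < N from hP)
      exact ih (by omega) (by omega)

open Classical in
lemma mu_eq (N : Submodule Λ Y) :
    mu Λ N = (if IndecSub Λ N then (1 / 2 : ℝ) ^ subLen Λ N else 0)
      + sSup (mu Λ '' {P : Submodule Λ Y | P < N}) := by
  rw [mu, muAux_eq_of_le le_rfl (Nat.le_succ _), muAux]
  congr 1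
  · simp
  · congr 1
    refine Set.image_congr fun P hP => ?_
    exact muAux_eq_of_le (subLen_strictMono (show P < N from hP)).le le_rfl

lemma exists_mu_eq_mul (N : Submodule Λ Y) :
    ∃ a : ℕ, a < 2 ^ subLen Λ N ∧ mu Λ N = a * (1 / 2 : ℝ) ^ subLen Λ N := by
  induction hn : subLen Λ N using Nat.strong_induction_on generalizing N with
  | _ n ih =>
  subst hn
  by_cases hN : N = ⊥
  · subst hN
    exact ⟨0, by simp, by simp [mu_bot]⟩
  have hpos := subLen_pos hN
  obtain ⟨l, hl⟩ : ∃ l, subLen Λ N = l + 1 := ⟨subLen Λ N - 1, by omega⟩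
  have hS : mu Λ '' {P : Submodule Λ Y | P < N} ⊆
      (fun a : ℕ => (a : ℝ) * (1 / 2 : ℝ) ^ l) '' Set.Iio (2 ^ l) := by
    rintro _ ⟨P, hP, rfl⟩
    have hlt := subLen_strictMono (show P < N from hP)
    obtain ⟨a, ha, hPa⟩ := ih _ hlt P rfl
    obtain ⟨d, hd⟩ : ∃ d, l = subLen Λ P + d := ⟨l - subLen Λ P, by omega⟩
    refine ⟨a * 2 ^ d, ?_, ?_⟩
    · rw [Set.mem_Iio, hd, pow_add]
      exact Nat.mul_lt_mul_of_pos_right ha (by positivity)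
    · rw [hPa, hd]
      simp only [Nat.cast_mul, Nat.cast_pow, Nat.cast_ofNat, pow_add]
      rw [show (a : ℝ) * 2 ^ d * ((1 / 2) ^ subLen Λ P * (1 / 2) ^ d)
        = a * (1 / 2) ^ subLen Λ P * (2 * (1 / 2)) ^ d by rw [mul_pow]; ring]
      norm_num
  have hmem := hS (Set.Nonempty.csSup_mem (Set.Nonempty.image _ ⟨⊥, bot_lt_iff_ne_bot.2 hN⟩)
    ((Set.finite_Iio _).image _ |>.subset hS))
  obtain ⟨a, ha, hsup⟩ := hmem
  rw [Set.mem_Iio] at ha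
  rw [mu_eq, ← hsup, hl]
  split_ifs
  · refine ⟨2 * a + 1, by rw [pow_succ]; omega, ?_⟩
    push_cast
    ring
  · refine ⟨2 * a, by rw [pow_succ]; omega, ?_⟩
    push_cast
    ring

lemma exists_nat_mu_eq_mul {N : Submodule Λ Y} {l : ℕ} (hl : subLen Λ N ≤ l) :
    ∃ a : ℕ, mu Λ N = a * (1 / 2 : ℝ) ^ l := by
  obtain ⟨a, -, h⟩ := exists_mu_eq_mul N
  obtain ⟨d, rfl⟩ := Nat.exists_eq_add_of_le hl
  refine ⟨a * 2 ^ d, ?_⟩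
  rw [h]
  push_cast
  rw [pow_add, show (a : ℝ) * 2 ^ d * ((1 / 2) ^ subLen Λ N * (1 / 2) ^ d)
        = a * (1 / 2) ^ subLen Λ N * (2 * (1 / 2)) ^ d by rw [mul_pow]; ring]
  norm_num

/-- Two measures of modules of length at most `l` differ by at least `2 ^ (-l)`. -/
lemma mu_add_le_of_lt {A : Type v} [AddCommGroup A] [Module Λ A] [IsNoetherian Λ A]
    [IsArtinian Λ A] {P : Submodule Λ Y} {Q : Submodule Λ A} {l : ℕ} (hP : subLen Λ P ≤ l)
    (hQ : subLen Λ Q ≤ l) (h : mu Λ P < mu Λ Q) : mu Λ P + (1 / 2 : ℝ) ^ l ≤ mu Λ Q := by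
  obtain ⟨a, ha⟩ := exists_nat_mu_eq_mul hP
  obtain ⟨b, hb⟩ := exists_nat_mu_eq_mul hQ
  have hpos : (0 : ℝ) < (1 / 2) ^ l := by positivity
  rw [ha, hb] at h ⊢
  have hab : a < b := by exact_mod_cast lt_of_mul_lt_mul_right h hpos.le
  have : (a : ℝ) + 1 ≤ b := by exact_mod_cast hab
  nlinarith

lemma finite_mu_image (N : Submodule Λ Y) : (mu Λ '' {P : Submodule Λ Y | P < N}).Finite := by
  refine ((Set.finite_Iio (2 ^ subLen Λ N)).image
    (fun a : ℕ => (a : ℝ) * (1 / 2 : ℝ) ^ subLen Λ N)).subset ?_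
  rintro _ ⟨P, hP, rfl⟩
  have hlt := subLen_strictMono (show P < N from hP)
  obtain ⟨a, ha, hPa⟩ := exists_mu_eq_mul P
  obtain ⟨b, hb⟩ := exists_nat_mu_eq_mul hlt.le
  refine ⟨b, ?_, hb.symm⟩
  have h1 : mu Λ P < 1 := by
    rw [hPa, one_div, inv_pow, ← div_eq_mul_inv, div_lt_one (by positivity)]
    exact_mod_cast ha
  rw [hb, one_div, inv_pow, ← div_eq_mul_inv, div_lt_one (by positivity)] at h1
  exact_mod_cast h1

lemma mu_mono : Monotone (mu Λ (Y := Y)) := fun P N h => by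
  rcases h.eq_or_lt with rfl | h
  · exact le_rfl
  rw [mu_eq N]
  have := le_csSup (finite_mu_image N).bddAbove ⟨P, h, rfl⟩
  split_ifs
  · have : (0 : ℝ) ≤ (1 / 2) ^ subLen Λ N := by positivity
    linarith
  · linarith

lemma IndecSub.mu_add_le {P N : Submodule Λ Y} (hN : IndecSub Λ N) (h : P < N) :
    mu Λ P + (1 / 2 : ℝ) ^ subLen Λ N ≤ mu Λ N := by
  rw [mu_eq N, if_pos hN]
  have := le_csSup (finite_mu_image N).bddAbove ⟨P, h, rfl⟩
  linarith

lemma IndecSub.mu_lt {P N : Submodule Λ Y} (hN : IndecSub Λ N) (h : P < N) :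
    mu Λ P < mu Λ N := by
  have := hN.mu_add_le h
  have : (0 : ℝ) < (1 / 2) ^ subLen Λ N := by positivity
  linarith

lemma IndecSub.mu_pos {N : Submodule Λ Y} (hN : IndecSub Λ N) : 0 < mu Λ N := by
  have := hN.mu_lt (bot_lt_iff_ne_bot.2 hN.1)
  rwa [mu_bot] at this

lemma exists_lt_mu_eq (N : Submodule Λ Y) (hN : N ≠ ⊥) : ∃ P < N,
    sSup (mu Λ '' {P : Submodule Λ Y | P < N}) = mu Λ P := by
  obtain ⟨P, hP, h⟩ := Set.Nonempty.csSup_mem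
    (Set.Nonempty.image (mu Λ) ⟨⊥, show ⊥ < N from bot_lt_iff_ne_bot.2 hN⟩) (finite_mu_image N)
  exact ⟨P, hP, h.symm⟩

/-- The measure of a nonzero module is attained at an indecomposable submodule. -/
lemma exists_indecSub_mu_eq (N : Submodule Λ Y) (hN : N ≠ ⊥) :
    ∃ P ≤ N, IndecSub Λ P ∧ mu Λ P = mu Λ N := by
  induction hn : subLen Λ N using Nat.strong_induction_on generalizing N with
  | _ n ih =>
  subst hn
  by_cases hind : IndecSub Λ N
  · exact ⟨N, le_rfl, hind, rfl⟩
  obtain ⟨P, hP, h⟩ := exists_lt_mu_eq N hN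
  have hmu : mu Λ N = mu Λ P := by rw [mu_eq, if_neg hind, h, zero_add]
  by_cases hP0 : P = ⊥
  · obtain ⟨A, B, hA, hB, hs, hi, hA0, hB0⟩ : ∃ A B : Submodule Λ Y, A ≤ N ∧ B ≤ N ∧
        A ⊔ B = N ∧ A ⊓ B = ⊥ ∧ A ≠ ⊥ ∧ B ≠ ⊥ := by
      simpa [IndecSub, hN] using hind
    have hAN : A < N := by
      refine lt_of_le_of_ne hA fun h => hB0 ?_
      rw [h, inf_eq_right.2 hB] at hi
      exact hi
    obtain ⟨Q, hQ, hQi, hQm⟩ := ih _ (subLen_strictMono hAN) A hA0 rfl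
    have h1 := mu_mono hA
    rw [hmu, hP0, mu_bot, ← hQm] at h1
    exact absurd hQi.mu_pos (by linarith)
  · obtain ⟨Q, hQ, hQi, hQm⟩ := ih _ (subLen_strictMono hP) P hP0 rfl
    exact ⟨Q, hQ.trans hP.le, hQi, hQm.trans hmu.symm⟩

lemma mu_map {A : Type v} [AddCommGroup A] [Module Λ A] [IsNoetherian Λ A]
    [IsArtinian Λ A] {f : Y →ₗ[Λ] A} (hf : Function.Injective f) (N : Submodule Λ Y) :
    mu Λ (N.map f) = mu Λ N := by
  induction hn : subLen Λ N using Nat.strong_induction_on generalizing N with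
  | _ n ih =>
  subst hn
  rw [mu_eq N, mu_eq (N.map f), ← (Submodule.equivMapOfInjective f hf N).subLen_eq]
  congr 1
  · classical exact if_congr (indecSub_map_iff hf N) rfl rfl
  · congr 1
    ext r
    constructor
    · rintro ⟨P, hP, rfl⟩
      obtain ⟨P, rfl⟩ : ∃ P' : Submodule Λ Y, P'.map f = P :=
        ⟨P.comap f, Submodule.map_comap_eq_self ((le_of_lt hP).trans (LinearMap.map_le_range))⟩
      have hPN : P < N := by
        rw [Set.mem_ofPred_eq, lt_iff_le_not_ge, Submodule.map_le_map_iff_of_injective hf,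
          Submodule.map_le_map_iff_of_injective hf] at hP
        exact lt_iff_le_not_ge.2 hP
      exact ⟨P, hPN, (ih _ (subLen_strictMono hPN) P rfl).symm⟩
    · rintro ⟨P, hP, rfl⟩
      exact ⟨P.map f, Submodule.map_strictMono_of_injective hf hP,
        ih _ (subLen_strictMono hP) P rfl⟩

lemma mu_subtype_top (N : Submodule Λ Y) : mu Λ (⊤ : Submodule Λ N) = mu Λ N := by
  rw [← mu_map N.injective_subtype, Submodule.map_subtype_top]

lemma LinearEquiv.mu_top_eq {A B : Type v} [AddCommGroup A] [Module Λ A] [IsNoetherian Λ A]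
    [IsArtinian Λ A] [AddCommGroup B] [Module Λ B] [IsNoetherian Λ B] [IsArtinian Λ B]
    (e : A ≃ₗ[Λ] B) : mu Λ (⊤ : Submodule Λ A) = mu Λ (⊤ : Submodule Λ B) := by
  rw [← mu_map e.injective, Submodule.map_top, LinearEquiv.range]

lemma LinearEquiv.mu_eq {A B : Type v} [AddCommGroup A] [Module Λ A] [IsNoetherian Λ A]
    [IsArtinian Λ A] [AddCommGroup B] [Module Λ B] [IsNoetherian Λ B] [IsArtinian Λ B]
    {P : Submodule Λ A} {Q : Submodule Λ B} (e : P ≃ₗ[Λ] Q) : mu Λ P = mu Λ Q := by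
  rw [← mu_subtype_top P, e.mu_top_eq, mu_subtype_top]

end Recursion

end Measure

section GabrielRoiterSteps

variable {Λ : Type u} [Ring Λ] {Y : Type v} [AddCommGroup Y] [Module Λ Y]

/-- The submodule `N` is indecomposable and `X` is a Gabriel-Roiter submodule of `N`. -/
structure GRStep (X N : Submodule Λ Y) : Prop where
  lt : X < N
  indec_left : IndecSub Λ X
  indec_right : IndecSub Λ N
  mu_eq : mu Λ N = mu Λ X + (1 / 2 : ℝ) ^ subLen Λ N

/-- A Gabriel-Roiter submodule is not a proper direct summand. -/
lemma GRStep.not_isCompl {X N : Submodule Λ Y} (h : GRStep X N) {C : Submodule Λ Y} (hC : C ≤ N)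
    (hs : X ⊔ C = N) (hi : X ⊓ C = ⊥) : False := by
  rcases h.indec_right.2 X C h.lt.le hC hs hi with h0 | h0
  · exact h.indec_left.1 h0
  · rw [h0, sup_bot_eq] at hs
    exact h.lt.ne hs

/-- There is a chain of Gabriel-Roiter inclusions from `X` to `N`. -/
abbrev GRChain (X N : Submodule Λ Y) : Prop := Relation.ReflTransGen GRStep X N

lemma GRChain.le {X N : Submodule Λ Y} (h : GRChain X N) : X ≤ N := by
  induction h with
  | refl => exact le_rfl
  | tail _ h ih => exact ih.trans h.lt.le

variable [IsNoetherian Λ Y] [IsArtinian Λ Y]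

lemma IndecSub.exists_grStep {N P : Submodule Λ Y} (hN : IndecSub Λ N) (hP : P ≠ ⊥)
    (hPN : P < N) : ∃ X, GRStep X N := by
  obtain ⟨Q, hQ, h⟩ := exists_lt_mu_eq N hN.1
  have hmu : mu Λ N = mu Λ Q + (1 / 2 : ℝ) ^ subLen Λ N := by
    rw [_root_.mu_eq, if_pos hN, h, add_comm]
  have hQ0 : Q ≠ ⊥ := by
    rintro rfl
    obtain ⟨R, hRP, hR, -⟩ := exists_indecSub_mu_eq P hP
    have h1 := hN.mu_add_le (hRP.trans_lt hPN)
    have h2 := hR.mu_pos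
    rw [hmu, mu_bot] at h1
    linarith
  obtain ⟨X, hX, hXi, hXm⟩ := exists_indecSub_mu_eq Q hQ0
  exact ⟨X, hX.trans_lt hQ, hXi, hN, by rw [hmu, hXm]⟩

lemma GRStep.mu_lt {A : Type v} [AddCommGroup A] [Module Λ A] [IsNoetherian Λ A]
    [IsArtinian Λ A] {X N : Submodule Λ Y} (h : GRStep X N) {P : Submodule Λ A}
    (hP : subLen Λ P < subLen Λ N) (hmu : mu Λ X < mu Λ P) : mu Λ N < mu Λ P := by
  obtain ⟨l, hl⟩ : ∃ l, subLen Λ N = l + 1 := ⟨subLen Λ N - 1, by omega⟩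
  have h1 := subLen_strictMono h.lt
  have h2 := mu_add_le_of_lt (l := l) (by omega) (by omega) hmu
  rw [h.mu_eq, hl, pow_succ]
  have : (0 : ℝ) < (1 / 2) ^ l := by positivity
  linarith

lemma exists_ne_bot_lt {N : Submodule Λ Y} (h : 1 < subLen Λ N) : ∃ P, P ≠ ⊥ ∧ P < N := by
  by_contra! hcon
  have : Order.height N ≤ (1 : ℕ) := by
    rw [Order.height_le_coe_iff]
    intro P hP
    have : P = ⊥ := by
      by_contra h0
      exact hcon P h0 hP
    simp [this]
  rw [← coe_subLen] at this
  have : subLen Λ N ≤ 1 := by exact_mod_cast this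
  omega

lemma two_mul_half_pow_le {a b : ℕ} (h : a < b) : 2 * (1 / 2 : ℝ) ^ b ≤ (1 / 2) ^ a := by
  have h1 : (1 / 2 : ℝ) ^ b ≤ (1 / 2) ^ (a + 1) :=
    pow_le_pow_of_le_one (by norm_num) (by norm_num) h
  rw [pow_succ] at h1
  linarith

lemma GRChain.mu_le {X N : Submodule Λ Y} (h : GRChain X N) :
    mu Λ N ≤ mu Λ X + (1 / 2 : ℝ) ^ subLen Λ X - (1 / 2) ^ subLen Λ N := by
  induction h with
  | refl => linarith
  | tail _ h ih =>
    have := two_mul_half_pow_le (subLen_strictMono h.lt)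
    linarith [h.mu_eq]

lemma IndecSub.exists_grChain {N : Submodule Λ Y} (hN : IndecSub Λ N) {l : ℕ} (hl : 1 ≤ l) :
    ∃ X, GRChain X N ∧ subLen Λ X ≤ l ∧ mu Λ N < mu Λ X + (1 / 2 : ℝ) ^ l := by
  suffices H : ∃ X, GRChain X N ∧ subLen Λ X ≤ l ∧ (X = N ∨
      mu Λ N ≤ mu Λ X + (1 / 2 : ℝ) ^ l - (1 / 2 : ℝ) ^ subLen Λ N) by
    obtain ⟨X, h1, h2, h⟩ := H
    refine ⟨X, h1, h2, ?_⟩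
    have hp : ∀ n : ℕ, (0 : ℝ) < (1 / 2) ^ n := fun n => by positivity
    rcases h with rfl | h
    · linarith [hp l]
    · linarith [hp (subLen Λ N)]
  induction hn : subLen Λ N using Nat.strong_induction_on generalizing N with
  | _ n ih =>
  subst hn
  by_cases hNl : subLen Λ N ≤ l
  · exact ⟨N, .refl, hNl, .inl rfl⟩
  obtain ⟨P, hP0, hP⟩ := exists_ne_bot_lt (N := N) (by omega)
  obtain ⟨X, hX⟩ := hN.exists_grStep hP0 hP
  obtain ⟨Z, hZ, hZl, h⟩ := ih _ (subLen_strictMono hX.lt) hX.indec_left rfl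
  refine ⟨Z, hZ.tail hX, hZl, .inr ?_⟩
  rcases h with rfl | h
  · linarith [hX.mu_eq, two_mul_half_pow_le (not_le.1 hNl)]
  · linarith [hX.mu_eq, two_mul_half_pow_le (subLen_strictMono hX.lt)]

end GabrielRoiterSteps

section MainProperty

variable {Λ : Type u} [Ring Λ] {Y : Type v} [AddCommGroup Y] [Module Λ Y]
  [IsNoetherian Λ Y] [IsArtinian Λ Y]

lemma mu_map_of_inf_ker {A : Type v} [AddCommGroup A] [Module Λ A] [IsNoetherian Λ A]
    [IsArtinian Λ A] (f : Y →ₗ[Λ] A) (N : Submodule Λ Y) (h : N ⊓ LinearMap.ker f = ⊥) :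
    mu Λ (N.map f) = mu Λ N :=
  (equivMapOfDisjoint f N h).mu_eq.symm

/-- The conclusion of Gabriel's main property for the submodule `X`, with two target modules. -/
def MainProperty (X : Submodule Λ Y) : Prop :=
  ∀ (A B : Type v) [AddCommGroup A] [Module Λ A] [IsNoetherian Λ A] [IsArtinian Λ A]
    [AddCommGroup B] [Module Λ B] [IsNoetherian Λ B] [IsArtinian Λ B]
    (f : Y →ₗ[Λ] A) (g : Y →ₗ[Λ] B),
    X ⊓ LinearMap.ker f ⊓ LinearMap.ker g = ⊥ →
    X ⊓ LinearMap.ker f = ⊥ ∨ X ⊓ LinearMap.ker g = ⊥ ∨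
      mu Λ X < mu Λ (X.map f) ∨ mu Λ X < mu Λ (X.map g)

lemma MainProperty.exists_isCompl {X N : Submodule Λ Y} (hX : MainProperty X) (hXN : X ≤ N)
    {A : Type v} [AddCommGroup A] [Module Λ A] [IsNoetherian Λ A] [IsArtinian Λ A]
    (hX0 : X ≠ ⊥) (f : Y →ₗ[Λ] A) (hf : X ⊓ LinearMap.ker f = ⊥)
    (hmu : mu Λ (N.map f) = mu Λ X) :
    ∃ C ≤ N, X ⊔ C = N ∧ X ⊓ C = ⊥ := by
  induction hn : subLen Λ (N.map f) using Nat.strong_induction_on generalizing A with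
  | _ n ih =>
  subst hn
  have hmap : X.map f ≤ N.map f := Submodule.map_mono hXN
  have hmapX := mu_map_of_inf_ker f X hf
  have hN0 : N.map f ≠ ⊥ := by
    intro h
    rw [h, le_bot_iff, ← LinearMap.le_ker_iff_map] at hmap
    rw [inf_eq_left.2 hmap] at hf
    exact hX0 hf
  by_cases hind : IndecSub Λ (N.map f)
  · have heq : X.map f = N.map f := by
      by_contra hne
      have := hind.mu_lt (lt_of_le_of_ne hmap hne)
      linarith
    refine ⟨N ⊓ LinearMap.ker f, inf_le_left, ?_, ?_⟩
    · refine le_antisymm (sup_le hXN inf_le_left) fun y hy => ?_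
      obtain ⟨x, hx, hxy⟩ : f y ∈ X.map f := heq ▸ Submodule.mem_map_of_mem hy
      refine Submodule.mem_sup.2 ⟨x, hx, y - x, ⟨N.sub_mem hy (hXN hx), ?_⟩, by abel⟩
      simp [hxy]
    · rw [← inf_assoc, inf_eq_left.2 hXN, hf]
  obtain ⟨P, Q, hP, hQ, hs, hi, hP0, hQ0⟩ : ∃ P Q : Submodule Λ A, P ≤ N.map f ∧
      Q ≤ N.map f ∧ P ⊔ Q = N.map f ∧ P ⊓ Q = ⊥ ∧ P ≠ ⊥ ∧ Q ≠ ⊥ := by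
    simpa [IndecSub, hN0] using hind
  have key : ∀ P Q : Submodule Λ A, P ≤ N.map f → Q ≤ N.map f → P ⊔ Q = N.map f →
      P ⊓ Q = ⊥ → Q ≠ ⊥ →
      mu Λ (N.map (Q.mkQ ∘ₗ f)) ≤ mu Λ X ∧
      subLen Λ (N.map (Q.mkQ ∘ₗ f)) < subLen Λ (N.map f) := by
    intro P Q hP hQ hs hi hQ0
    have hPQ : N.map (Q.mkQ ∘ₗ f) = P.map Q.mkQ := by
      rw [Submodule.map_comp, ← hs, Submodule.map_sup]
      simp
    have hker : P ⊓ LinearMap.ker Q.mkQ = ⊥ := by simpa using hi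
    have hlt : P < N.map f := by
      refine lt_of_le_of_ne hP fun h => hQ0 ?_
      rwa [h, inf_eq_right.2 hQ] at hi
    rw [hPQ, mu_map_of_inf_ker _ _ hker, ← (equivMapOfDisjoint _ _ hker).subLen_eq, ← hmu]
    exact ⟨mu_mono hP, subLen_strictMono hlt⟩
  obtain ⟨h1, h2⟩ := key P Q hP hQ hs hi hQ0
  obtain ⟨h3, h4⟩ := key Q P hQ hP (sup_comm P Q ▸ hs) (inf_comm P Q ▸ hi) hP0
  have hle : ∀ R : Submodule Λ A, mu Λ (X.map (R.mkQ ∘ₗ f)) ≤ mu Λ (N.map (R.mkQ ∘ₗ f)) :=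
    fun R => mu_mono (Submodule.map_mono hXN)
  have hker : X ⊓ LinearMap.ker (Q.mkQ ∘ₗ f) ⊓ LinearMap.ker (P.mkQ ∘ₗ f) = ⊥ := by
    rw [eq_bot_iff]
    rintro x ⟨⟨hx, hxQ⟩, hxP⟩
    have hxQ : f x ∈ Q := by simpa using hxQ
    have hxP : f x ∈ P := by simpa using hxP
    have : f x ∈ P ⊓ Q := ⟨hxP, hxQ⟩
    rw [hi] at this
    rw [← hf]
    exact ⟨hx, by simpa using this⟩
  rcases hX _ _ (Q.mkQ ∘ₗ f) (P.mkQ ∘ₗ f) hker with h | h | h | h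
  · refine ih _ h2 _ h (le_antisymm h1 ?_) rfl
    rw [← mu_map_of_inf_ker _ _ h]
    exact hle Q
  · refine ih _ h4 _ h (le_antisymm h3 ?_) rfl
    rw [← mu_map_of_inf_ker _ _ h]
    exact hle P
  · linarith [hle Q]
  · linarith [hle P]

/-- Gabriel's main property: an indecomposable module which embeds into `A ⊕ B` embeds into one
of the two summands, or has strictly smaller measure than one of its images in `A`, `B`. -/
theorem IndecSub.mainProperty {N : Submodule Λ Y} (hN : IndecSub Λ N) : MainProperty N := by
  induction hn : subLen Λ N using Nat.strong_induction_on generalizing N with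
  | _ n ih =>
  subst hn
  intro A B _ _ _ _ _ _ _ _ f g hfg
  by_contra! hcon
  obtain ⟨hf, hg, hmf, hmg⟩ := hcon
  have hfN : N ⊓ LinearMap.ker f < N := by
    refine lt_of_le_of_ne inf_le_left fun h => hg ?_
    rwa [h] at hfg
  obtain ⟨X, hX⟩ := hN.exists_grStep hf hfN
  have hXm := ih _ (subLen_strictMono hX.lt) hX.indec_left rfl
  have key : ∀ (A : Type v) [AddCommGroup A] [Module Λ A] [IsNoetherian Λ A] [IsArtinian Λ A]
      (f : Y →ₗ[Λ] A), N ⊓ LinearMap.ker f ≠ ⊥ → mu Λ (N.map f) ≤ mu Λ N →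
      X ⊓ LinearMap.ker f ≠ ⊥ ∧ mu Λ (X.map f) ≤ mu Λ X := by
    intro A _ _ _ _ f hf hmf
    have hlen : subLen Λ (N.map f) < subLen Λ N := by
      have := subLen_pos hf
      have := subLen_map_add f N
      omega
    have hle : mu Λ (N.map f) ≤ mu Λ X := by
      by_contra! h
      exact absurd (hX.mu_lt hlen h) hmf.not_gt
    have hXN : mu Λ (X.map f) ≤ mu Λ (N.map f) := mu_mono (Submodule.map_mono hX.lt.le)
    refine ⟨fun h => ?_, hXN.trans hle⟩
    rw [mu_map_of_inf_ker _ _ h] at hXN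
    obtain ⟨C, hC, hs, hi⟩ := hXm.exists_isCompl hX.lt.le hX.indec_left.1 f h (le_antisymm hle hXN)
    exact hX.not_isCompl hC hs hi
  obtain ⟨hf1, hf2⟩ := key A f hf hmf
  obtain ⟨hg1, hg2⟩ := key B g hg hmg
  have hXfg : X ⊓ LinearMap.ker f ⊓ LinearMap.ker g = ⊥ := by
    rw [eq_bot_iff, ← hfg]
    exact inf_le_inf_right _ (inf_le_inf_right _ hX.lt.le)
  rcases hXm A B f g hXfg with h | h | h | h
  · exact hf1 h
  · exact hg1 h
  · exact h.not_ge hf2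
  · exact h.not_ge hg2

end MainProperty

section Tower

variable {Λ : Type u} [Ring Λ] {M : Type v} [AddCommGroup M] [Module Λ M]
variable {Y : Type v} [AddCommGroup Y] [Module Λ Y]

/-- The quotient of `B` by `A ⊓ B` is isomorphic to `M`. -/
def IsFactor (M : Type v) [AddCommGroup M] [Module Λ M] (A B : Submodule Λ Y) : Prop :=
  Nonempty ((B ⧸ comap B.subtype A) ≃ₗ[Λ] M)

lemma isFactor_iff {A B : Submodule Λ Y} : IsFactor M A B ↔
    ∃ p : B →ₗ[Λ] M, Function.Surjective p ∧ ∀ x : B, p x = 0 ↔ (x : Y) ∈ A := by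
  constructor
  · rintro ⟨e⟩
    exact ⟨e.toLinearMap ∘ₗ (comap B.subtype A).mkQ,
      e.surjective.comp (Submodule.mkQ_surjective _), fun x => by simp⟩
  · rintro ⟨p, hp, hk⟩
    have : comap B.subtype A = LinearMap.ker p := by
      ext x
      simp [hk]
    exact ⟨(Submodule.quotEquivOfEq _ _ this).trans (p.quotKerEquivOfSurjective hp)⟩

lemma IsFactor.sup {A B C : Submodule Λ Y} (h : IsFactor M C B) (hC : A ⊓ B = C) :
    IsFactor M A (A ⊔ B) := by
  obtain ⟨e⟩ := h
  subst hC
  rw [sup_comm]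
  rw [inf_comm] at e
  exact ⟨(LinearMap.quotientInfEquivSupQuotient B A).symm.trans e⟩

lemma IsFactor.of_equiv {U : Submodule Λ Y} (e : U ≃ₗ[Λ] M) : IsFactor M ⊥ U :=
  isFactor_iff.2 ⟨e.toLinearMap, e.surjective, fun x => by simp⟩

section Length

variable [IsNoetherian Λ Y] [IsArtinian Λ Y]

lemma subLen_eq_of_surjective {U : Submodule Λ Y} {p : U →ₗ[Λ] M}
    (hp : Function.Surjective p) :
    subLen Λ U = subLen Λ ((LinearMap.ker p).map U.subtype) + subLen Λ (⊤ : Submodule Λ M) := by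
  have h := subLen_map_add p ⊤
  rw [top_inf_eq, Submodule.map_top, LinearMap.range_eq_top.2 hp,
    LinearEquiv.subLen_eq (Q := U) Submodule.topEquiv] at h
  rw [h, (Submodule.equivMapOfInjective U.subtype U.injective_subtype _).subLen_eq]

lemma IsFactor.subLen_eq {A B : Submodule Λ Y} (h : IsFactor M A B) (hAB : A ≤ B) :
    subLen Λ B = subLen Λ A + subLen Λ (⊤ : Submodule Λ M) := by
  obtain ⟨p, hp, hk⟩ := isFactor_iff.1 h
  rw [subLen_eq_of_surjective hp]
  congr 2
  ext x
  simp only [Submodule.mem_map, LinearMap.mem_ker, Submodule.coe_subtype, Subtype.exists,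
    exists_and_right, exists_eq_right]
  exact ⟨fun ⟨hx, h⟩ => (hk _).1 h, fun hx => ⟨hAB hx, (hk _).2 hx⟩⟩

/-- If `U` surjects onto `M`, the kernel contains `A`, and `U` is not too long, then the kernel
is `A`. -/
lemma isFactor_of_surjective {A U : Submodule Λ Y} (hAU : A ≤ U) {p : U →ₗ[Λ] M}
    (hp : Function.Surjective p) (hA : ∀ x : U, (x : Y) ∈ A → p x = 0)
    (hlen : subLen Λ U ≤ subLen Λ A + subLen Λ (⊤ : Submodule Λ M)) : IsFactor M A U := by
  have hle : A ≤ (LinearMap.ker p).map U.subtype := fun x hx => ⟨⟨x, hAU hx⟩, hA _ hx, rfl⟩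
  have h := subLen_eq_of_surjective hp
  have heq := eq_of_le_of_subLen_le hle (by omega)
  refine isFactor_iff.2 ⟨p, hp, fun x => ⟨fun hx => ?_, hA x⟩⟩
  rw [heq]
  exact ⟨x, hx, rfl⟩

end Length

/-- The properties of a homogeneous `M`-filtration `0 = d 0 ⊂ d 1 ⊂ ⋯ ⊂ d m = Y` which is the
only `M`-filtration that are used to determine the Gabriel-Roiter submodules of `Y`. -/
structure UniqueTower (M : Type v) [AddCommGroup M] [Module Λ M] (d : ℕ → Submodule Λ Y)
    (m : ℕ) : Prop where
  bot : d 0 = ⊥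
  top : d m = ⊤
  le : ∀ i < m, d i ≤ d (i + 1)
  factor : ∀ i < m, IsFactor M (d i) (d (i + 1))
  indec : ∀ i ≤ m, i ≠ 0 → IndecSub Λ (d i)
  retract : ∀ i < m, i ≠ 0 → ∀ N : Submodule Λ Y, d i ≤ N → N < d (i + 1) →
    ∃ r : N →ₗ[Λ] Y, LinearMap.range r ≤ d i ∧ ∀ x : N, (x : Y) ∈ d i → r x = x
  unique : ∀ i, i + 1 < m → ∀ W : Submodule Λ Y, d i ≤ W → W ≤ d (i + 2) →
    IsFactor M (d i) W → IsFactor M W (d (i + 2)) → W = d (i + 1)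

namespace UniqueTower

variable {d : ℕ → Submodule Λ Y} {m : ℕ}

lemma monotone (T : UniqueTower M d m) {i j : ℕ} (hij : i ≤ j) (hj : j ≤ m) : d i ≤ d j := by
  induction j, hij using Nat.le_induction with
  | base => exact le_rfl
  | succ j _ ih => exact (ih (by omega)).trans (T.le j (by omega))

lemma equiv_one (T : UniqueTower M d m) (hm : 0 < m) : Nonempty (d 1 ≃ₗ[Λ] M) := by
  obtain ⟨p, hp, hpk⟩ := isFactor_iff.1 (T.factor 0 hm)
  refine ⟨LinearEquiv.ofBijective p ⟨?_, hp⟩⟩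
  rw [← LinearMap.ker_eq_bot, eq_bot_iff]
  intro x hx
  have := (hpk x).1 hx
  rw [T.bot] at this
  simpa using this

lemma eq_succ_of_isFactor (T : UniqueTower M d m) (hM : IsBrick Λ M) {i : ℕ} (him : i ≤ m)
    {U : Submodule Λ Y} (hU : d i ≤ U) (hf : IsFactor M (d i) U) : i < m ∧ U = d (i + 1) := by
  classical
  obtain ⟨p, hp, hpk⟩ := isFactor_iff.1 hf
  have hex : ∃ j, U ≤ d j := ⟨m, by rw [T.top]; exact le_top⟩
  have hjm : Nat.find hex ≤ m := Nat.find_le (by rw [T.top]; exact le_top)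
  have hij : i < Nat.find hex := by
    by_contra! h
    have hUi := (Nat.find_spec hex).trans (T.monotone h him)
    obtain ⟨y, hy⟩ := hM.1
    obtain ⟨x, rfl⟩ := hp y
    exact hy ((hpk x).2 (hUi x.2))
  obtain ⟨j, hj⟩ : ∃ j, Nat.find hex = j + 1 := ⟨Nat.find hex - 1, by omega⟩
  have hUj : U ≤ d (j + 1) := hj ▸ Nat.find_spec hex
  have hUj' : ¬ U ≤ d j := Nat.find_min hex (by omega)
  rw [hj] at hjm hij
  clear hj hex
  obtain ⟨q, hq, hqk⟩ := isFactor_iff.1 (T.factor j (by omega))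
  have hle := T.le j (by omega)
  have hdij := T.monotone (i := i) (j := j) (by omega) (by omega)
  let f : U →ₗ[Λ] M := q ∘ₗ Submodule.inclusion hUj
  have hfk : ∀ x : U, f x = 0 ↔ (x : Y) ∈ d j := fun x => hqk _
  have hker : LinearMap.ker p ≤ LinearMap.ker f := fun x hx => by
    rw [LinearMap.mem_ker, hfk]
    exact hdij ((hpk x).1 hx)
  let e : M →ₗ[Λ] M :=
    (LinearMap.ker p).liftQ f hker ∘ₗ (p.quotKerEquivOfSurjective hp).symm.toLinearMap
  have hef : ∀ x, e (p x) = f x := fun x => by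
    have : (p.quotKerEquivOfSurjective hp).symm (p x) = (LinearMap.ker p).mkQ x := by
      rw [LinearEquiv.symm_apply_eq]
      rfl
    simp only [e, LinearMap.comp_apply, LinearEquiv.coe_coe, this]
    rfl
  have he : Function.Bijective e := by
    refine hM.2 e fun h0 => hUj' fun x hx => ?_
    rw [← hfk ⟨x, hx⟩, ← hef, h0]
    rfl
  have hinf : U ⊓ d j = d i := by
    refine le_antisymm (fun x hx => ?_) (le_inf hU hdij)
    rw [← hpk ⟨x, hx.1⟩]
    refine he.1 ?_
    rw [hef, map_zero, hfk]
    exact hx.2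
  have hsup : U ⊔ d j = d (j + 1) := by
    refine le_antisymm (sup_le hUj hle) fun y hy => ?_
    obtain ⟨z, hz⟩ := he.2 (q ⟨y, hy⟩)
    obtain ⟨u, rfl⟩ := hp z
    have hu : y - u ∈ d j := by
      rw [← hqk ⟨y - u, (d (j + 1)).sub_mem hy (hUj u.2)⟩]
      have : q ⟨y - u, (d (j + 1)).sub_mem hy (hUj u.2)⟩ = q ⟨y, hy⟩ - f u := by
        simp only [f, LinearMap.comp_apply]
        rw [← map_sub]
        rfl
      rw [this, ← hz, hef, sub_self]
    exact Submodule.mem_sup.2 ⟨u, u.2, y - u, hu, by abel⟩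
  rcases (show i ≤ j by omega).eq_or_lt with rfl | hlt
  · exact ⟨by omega, by rw [← hsup, sup_eq_left.2 hU]⟩
  exfalso
  obtain ⟨k, rfl⟩ : ∃ k, j = k + 1 := ⟨j - 1, by omega⟩
  have hk := T.le k (by omega)
  have hdik := T.monotone (i := i) (j := k) (by omega) (by omega)
  have h1 : d k ⊓ U = d i := le_antisymm
    (by rw [← hinf, inf_comm]; exact inf_le_inf_left _ hk) (le_inf hdik hU)
  have h2 : (d k ⊔ U) ⊓ d (k + 1) = d k := by
    rw [sup_inf_assoc_of_le U hk, hinf, sup_eq_left.2 hdik]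
  have h3 : d k ⊔ U ⊔ d (k + 1) = d (k + 2) := by
    rw [sup_right_comm, sup_eq_right.2 hk, sup_comm, hsup]
  have h4 : IsFactor M (d k ⊔ U) (d (k + 2)) := by
    rw [← h3]
    exact (T.factor k (by omega)).sup h2
  have := T.unique k (by omega) (d k ⊔ U) le_sup_left (sup_le (hk.trans hle) hUj)
    (hf.sup h1) h4
  exact hUj' (this ▸ le_sup_right)

lemma retract_or_surjective (T : UniqueTower M d m) {i j : ℕ} (hi : i ≠ 0) (hij : i ≤ j)
    (hj : j ≤ m) {U : Submodule Λ Y} (hiU : d i ≤ U) (hUj : U ≤ d j) :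
    (∃ r : U →ₗ[Λ] Y, LinearMap.range r ≤ d i ∧ ∀ x : U, (x : Y) ∈ d i → r x = x) ∨
    ∃ p : U →ₗ[Λ] M, Function.Surjective p ∧ ∀ x : U, (x : Y) ∈ d i → p x = 0 := by
  induction j, hij using Nat.le_induction generalizing U with
  | base => exact .inl ⟨U.subtype, by simpa using hUj, fun x _ => rfl⟩
  | succ j hij ih =>
    have hle := T.le j (by omega)
    have hdij := T.monotone hij (by omega)
    by_cases hN : U ⊔ d j = d (j + 1)
    · obtain ⟨q, hq, hqk⟩ := isFactor_iff.1 (T.factor j (by omega))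
      refine .inr ⟨q ∘ₗ Submodule.inclusion hUj, fun y => ?_, fun x hx => ?_⟩
      · obtain ⟨⟨x, hx⟩, rfl⟩ := hq y
        have hx' := hx
        rw [← hN] at hx'
        obtain ⟨u, hu, z, hz, rfl⟩ := Submodule.mem_sup.1 hx'
        refine ⟨⟨u, hu⟩, ?_⟩
        have h0 : q ⟨z, hle hz⟩ = 0 := (hqk _).2 hz
        calc q ⟨u, hUj hu⟩ = q ⟨u, hUj hu⟩ + q ⟨z, hle hz⟩ := by rw [h0, add_zero]
          _ = q ⟨u + z, hx⟩ := by rw [← map_add]; rfl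
      · exact (hqk _).2 (hdij hx)
    · obtain ⟨r, hr, hrx⟩ := T.retract j (by omega) (by omega) (U ⊔ d j) le_sup_right
        (lt_of_le_of_ne (sup_le hUj hle) hN)
      let s : U →ₗ[Λ] Y := r ∘ₗ Submodule.inclusion le_sup_left
      have hs : ∀ x : U, (x : Y) ∈ d i → s x = x := fun x hx => hrx _ (hdij hx)
      have hsr : LinearMap.range s ≤ d j := (LinearMap.range_comp_le_range _ _).trans hr
      have his : d i ≤ LinearMap.range s := fun x hx => ⟨⟨x, hiU hx⟩, hs _ hx⟩
      have hss : ∀ x : U, (x : Y) ∈ d i → ((s.rangeRestrict x : LinearMap.range s) : Y) = x :=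
        fun x hx => hs x hx
      rcases ih (by omega) his hsr with ⟨t, ht, htx⟩ | ⟨p, hp, hpx⟩
      · refine .inl ⟨t ∘ₗ s.rangeRestrict, (LinearMap.range_comp_le_range _ _).trans ht,
          fun x hx => ?_⟩
        rw [LinearMap.comp_apply, htx _ (by rwa [hss x hx]), hss x hx]
      · refine .inr ⟨p ∘ₗ s.rangeRestrict, hp.comp s.surjective_rangeRestrict, fun x hx => ?_⟩
        rw [LinearMap.comp_apply, hpx _ (by rwa [hss x hx])]

variable [IsNoetherian Λ Y] [IsArtinian Λ Y]

lemma eq_succ_of_indecSub (T : UniqueTower M d m) (hM : IsBrick Λ M) {i : ℕ} (hi : i ≠ 0)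
    (him : i < m) {U : Submodule Λ Y} (hU : IndecSub Λ U) (hiU : d i < U)
    (hlen : subLen Λ U ≤ subLen Λ (d (i + 1))) : U = d (i + 1) := by
  rcases T.retract_or_surjective hi him.le le_rfl hiU.le (T.top ▸ le_top) with
    ⟨r, hr, hrx⟩ | ⟨p, hp, hpx⟩
  · exfalso
    have hC : (LinearMap.ker r).map U.subtype ≤ U := by
      simpa using LinearMap.map_le_range (f := U.subtype) (p := LinearMap.ker r)
    have hrm : ∀ x : U, r x ∈ d i := fun x => hr ⟨x, rfl⟩
    have hsub : ∀ x : U, x - ⟨r x, hiU.le (hrm x)⟩ ∈ LinearMap.ker r := fun x => by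
      rw [LinearMap.mem_ker, map_sub, hrx ⟨_, _⟩ (hrm x), sub_self]
    have hsup : d i ⊔ (LinearMap.ker r).map U.subtype = U :=
      le_antisymm (sup_le hiU.le hC) fun x hx => Submodule.mem_sup.2
        ⟨_, hrm ⟨x, hx⟩, x - r ⟨x, hx⟩, ⟨_, hsub ⟨x, hx⟩, rfl⟩, by abel⟩
    have hinf : d i ⊓ (LinearMap.ker r).map U.subtype = ⊥ := by
      rw [eq_bot_iff]
      rintro _ ⟨hx, x, hxk, rfl⟩
      have := hrx x hx
      rw [LinearMap.mem_ker.1 hxk] at this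
      exact this.symm
    rcases hU.2 _ _ hiU.le hC hsup hinf with h | h
    · exact (T.indec i him.le hi).1 h
    · rw [h, sup_bot_eq] at hsup
      exact hiU.ne hsup
  · rw [(T.factor i him).subLen_eq (T.le i him)] at hlen
    exact (T.eq_succ_of_isFactor hM him.le hiU.le
      (isFactor_of_surjective hiU.le hp hpx hlen)).2

variable [IsNoetherian Λ M] [IsArtinian Λ M]

lemma equiv_or_mu_lt (T : UniqueTower M d m) (hM : IndecMod Λ M) {j : ℕ} (hj0 : 1 ≤ j)
    (hj : j ≤ m) {U : Submodule Λ Y} (hU : U ≤ d j)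
    (hlen : subLen Λ U ≤ subLen Λ (⊤ : Submodule Λ M)) :
    Nonempty (U ≃ₗ[Λ] M) ∨ mu Λ U < mu Λ (⊤ : Submodule Λ M) := by
  induction j, hj0 using Nat.le_induction generalizing U with
  | base =>
    obtain ⟨e⟩ := T.equiv_one (by omega)
    rcases hU.eq_or_lt with rfl | hlt
    · exact .inl ⟨e⟩
    · right
      rw [← e.mu_top_eq, mu_subtype_top]
      exact (T.indec 1 hj one_ne_zero).mu_lt hlt
  | succ j hj0 ih =>
    have ih' := fun {U} => ih (U := U) (by omega)
    clear ih
    suffices H : ∀ P ≤ d (j + 1), IndecSub Λ P → subLen Λ P ≤ subLen Λ (⊤ : Submodule Λ M) →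
        Nonempty (P ≃ₗ[Λ] M) ∨ mu Λ P < mu Λ (⊤ : Submodule Λ M) by
      by_cases hU0 : U = ⊥
      · right
        rw [hU0, mu_bot]
        exact IndecSub.mu_pos hM
      obtain ⟨P, hPU, hP, hPm⟩ := exists_indecSub_mu_eq U hU0
      have hPl := subLen_mono hPU
      rcases H P (hPU.trans hU) hP (by omega) with ⟨⟨e⟩⟩ | h
      · have h1 : subLen Λ P = subLen Λ (⊤ : Submodule Λ M) :=
          (e.trans Submodule.topEquiv.symm).subLen_eq
        have := eq_of_le_of_subLen_le hPU (by omega)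
        subst this
        exact .inl ⟨e⟩
      · exact .inr (hPm ▸ h)
    clear hU hlen U
    intro U hU hUi hlen
    have hle := T.le j (by omega)
    obtain ⟨q, hq, hqk⟩ := isFactor_iff.1 (T.factor j (by omega))
    by_cases hN : U ⊔ d j = d (j + 1)
    · left
      have hs : Function.Surjective (q ∘ₗ Submodule.inclusion hU) := fun y => by
        obtain ⟨⟨x, hx⟩, rfl⟩ := hq y
        have hx' := hx
        rw [← hN] at hx'
        obtain ⟨u, hu, z, hz, rfl⟩ := Submodule.mem_sup.1 hx'
        refine ⟨⟨u, hu⟩, ?_⟩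
        have h0 : q ⟨z, hle hz⟩ = 0 := (hqk _).2 hz
        calc q ⟨u, hU hu⟩ = q ⟨u, hU hu⟩ + q ⟨z, hle hz⟩ := by rw [h0, add_zero]
          _ = q ⟨u + z, hx⟩ := by rw [← map_add]; rfl
      have h := subLen_eq_of_surjective hs
      have h0 : (LinearMap.ker (q ∘ₗ Submodule.inclusion hU)).map U.subtype = ⊥ := by
        by_contra h0
        have := subLen_pos h0
        omega
      replace h0 := LinearMap.ker_eq_bot.1
        (map_injective_of_injective U.injective_subtype (h0.trans (Submodule.map_bot _).symm))
      exact ⟨LinearEquiv.ofBijective _ ⟨h0, hs⟩⟩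
    have hNlt := lt_of_le_of_ne (sup_le hU hle) hN
    obtain ⟨r, hr, hrx⟩ := T.retract j (by omega) (by omega) (U ⊔ d j) le_sup_right hNlt
    let N := U ⊔ d j
    let g : N →ₗ[Λ] M := q ∘ₗ Submodule.inclusion hNlt.le
    let U' : Submodule Λ N := comap N.subtype U
    have hUN : U ≤ N := le_sup_left
    let e : U' ≃ₗ[Λ] U := Submodule.comapSubtypeEquivOfLe hUN
    have hmapU : U'.map N.subtype = U := by simpa [U'] using hUN
    have hU'i : IndecSub Λ U' := by
      rwa [← indecSub_map_iff N.injective_subtype, hmapU]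
    have hmapr : U'.map r ≤ d j := LinearMap.map_le_range.trans hr
    have hlenr : subLen Λ (U'.map r) ≤ subLen Λ (⊤ : Submodule Λ M) := by
      have := subLen_map_add r U'
      have := e.subLen_eq
      omega
    have hmapg : mu Λ (U'.map g) < mu Λ (⊤ : Submodule Λ M) := by
      refine IndecSub.mu_lt hM (lt_top_iff_ne_top.2 fun htop => hNlt.not_ge fun x hx => ?_)
      obtain ⟨u, hu, hux⟩ : q ⟨x, hx⟩ ∈ U'.map g := htop ▸ trivial
      have h0 : x - u ∈ d j := by
        rw [← hqk ⟨x - u, (d (j + 1)).sub_mem hx (hNlt.le u.2)⟩]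
        calc q ⟨x - u, _⟩ = q ⟨x, hx⟩ - g u := by
              simp only [g, LinearMap.comp_apply]
              rw [← map_sub]
              rfl
          _ = 0 := by rw [hux, sub_self]
      exact Submodule.mem_sup.2 ⟨u, hu, x - u, h0, by abel⟩
    have hker : U' ⊓ LinearMap.ker r ⊓ LinearMap.ker g = ⊥ := by
      rw [eq_bot_iff]
      rintro x ⟨⟨-, hxr⟩, hxg⟩
      have hxj : (x : Y) ∈ d j := (hqk _).1 hxg
      have h0 := hrx x hxj
      rw [LinearMap.mem_ker.1 hxr] at h0
      exact Subtype.ext h0.symm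
    have hmu : mu Λ U = mu Λ U' := e.mu_eq.symm
    rcases hU'i.mainProperty Y M r g hker with h | h | h | h
    · let er := equivMapOfDisjoint r U' h
      rcases ih' hmapr hlenr with ⟨⟨e'⟩⟩ | h'
      · exact .inl ⟨(e.symm.trans er).trans e'⟩
      · right
        rwa [hmu, er.mu_eq]
    · right
      rwa [hmu, ← mu_map_of_inf_ker _ _ h]
    · right
      rw [hmu]
      rcases ih' hmapr hlenr with ⟨⟨e'⟩⟩ | h'
      · rwa [← e'.mu_top_eq, mu_subtype_top]
      · exact h.trans h'
    · right
      rw [hmu]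
      exact h.trans hmapg

lemma grChain (T : UniqueTower M d m) (hMi : IndecMod Λ M) (hM : IsBrick Λ M) {i : ℕ}
    (hi : 1 ≤ i) (him : i ≤ m) {N : Submodule Λ Y} (hN : IndecSub Λ N)
    (hmu : mu Λ (d i) ≤ mu Λ N) : GRChain (d i) N := by
  induction i, hi using Nat.le_induction with
  | base =>
    have hf := T.factor 0 (by omega)
    have hlen := hf.subLen_eq (T.le 0 (by omega))
    rw [T.bot, subLen_bot, zero_add, zero_add] at hlen
    obtain ⟨e⟩ := T.equiv_one (by omega)
    obtain ⟨X, hX, hXl, hXm⟩ := hN.exists_grChain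
      (Nat.succ_le_of_lt (subLen_pos (T.indec 1 him one_ne_zero).1))
    have hle : mu Λ (d 1) ≤ mu Λ X := by
      by_contra! h
      have := mu_add_le_of_lt hXl le_rfl h
      linarith
    rcases T.equiv_or_mu_lt hMi (hj0 := by omega) le_rfl (U := X) (T.top ▸ le_top)
      (hXl.trans hlen.le) with ⟨⟨e'⟩⟩ | h
    · have := (T.eq_succ_of_isFactor hM (Nat.zero_le m) (T.bot ▸ bot_le)
        (T.bot ▸ IsFactor.of_equiv e')).2
      exact this ▸ hX
    · rw [← e.mu_top_eq, mu_subtype_top] at h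
      linarith
  | succ i hi ih =>
    have hlt : d i < d (i + 1) := by
      refine lt_of_le_of_ne (T.le i (by omega)) fun h => ?_
      have h1 := (T.factor i (by omega)).subLen_eq (T.le i (by omega))
      have h2 := subLen_pos hMi.1
      rw [← h] at h1
      omega
    have hdi := (T.indec (i + 1) him (by omega)).mu_add_le hlt
    have hpos : ∀ n : ℕ, (0 : ℝ) < (1 / 2) ^ n := fun n => by positivity
    have hc := ih (by omega) (by linarith [hpos (subLen Λ (d (i + 1)))])
    rcases hc.cases_head with h | ⟨U, hdU, hUN⟩
    · rw [← h] at hmu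
      linarith [hpos (subLen Λ (d (i + 1)))]
    · have hUle : subLen Λ U ≤ subLen Λ (d (i + 1)) := by
        by_contra! h
        linarith [two_mul_half_pow_le h, GRChain.mu_le hUN, hdU.mu_eq, hpos (subLen Λ N)]
      rwa [← T.eq_succ_of_indecSub hM (by omega) (by omega) hdU.indec_right hdU.lt hUle]

theorem isGRSub_iff (T : UniqueTower M d m) (hMi : IndecMod Λ M) (hM : IsBrick Λ M)
    (hm : 2 ≤ m) (X : Submodule Λ Y) : IsGRSub Λ X ↔ X = d (m - 1) := by
  obtain ⟨i, rfl⟩ : ∃ i, m = i + 1 := ⟨m - 1, by omega⟩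
  rw [Nat.add_sub_cancel]
  have hY : IndecSub Λ (⊤ : Submodule Λ Y) := T.top ▸ T.indec (i + 1) le_rfl (by omega)
  have hdi := T.indec i (by omega) (by omega)
  have hlt : d i < ⊤ := by
    rw [← T.top]
    refine lt_of_le_of_ne (T.le i (by omega)) fun h => ?_
    have h1 := (T.factor i (by omega)).subLen_eq (T.le i (by omega))
    have h2 := subLen_pos hMi.1
    rw [← h] at h1
    omega
  have hpow : (2 : ℝ) ^ (-(subLen Λ (⊤ : Submodule Λ Y) : ℤ)) =
      (1 / 2) ^ subLen Λ (⊤ : Submodule Λ Y) := by simp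
  have key : ∀ X : Submodule Λ Y, IsGRSub Λ X → X = d i := by
    rintro X ⟨-, hX, hXt, hmu⟩
    rw [hpow] at hmu
    have hle := (T.grChain hMi hM (i := i) (by omega) (by omega) hX
      (by linarith [hY.mu_add_le hlt])).le
    by_contra hne
    refine hXt ?_
    rw [← T.top]
    exact T.eq_succ_of_indecSub hM (by omega) (by omega) hX (lt_of_le_of_ne hle (Ne.symm hne))
      (subLen_mono (T.top ▸ le_top))
  refine ⟨key X, ?_⟩
  rintro rfl
  obtain ⟨Z, hZ⟩ := hY.exists_grStep hdi.1 hlt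
  have hZGR : IsGRSub Λ Z := ⟨hY, hZ.indec_left, hZ.lt.ne, by rw [hpow, hZ.mu_eq]⟩
  rwa [← key Z hZGR]

end UniqueTower

end Tower

section HomogeneousFiltration

variable {Λ : Type u} [Ring Λ] {M : Type v} [AddCommGroup M] [Module Λ M]
variable {Y : Type v} [AddCommGroup Y] [Module Λ Y]

lemma IsFactor.ne (hM : ∃ x : M, x ≠ 0) {A B : Submodule Λ Y} (h : IsFactor M A B) : A ≠ B := by
  rintro rfl
  obtain ⟨p, hp, hpk⟩ := isFactor_iff.1 h
  obtain ⟨y, hy⟩ := hM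
  obtain ⟨x, rfl⟩ := hp y
  exact hy ((hpk x).2 x.2)

lemma IsIrreducibleHom.exists_retract [IsNoetherian Λ Y] [IsArtinian Λ Y] {A B : Submodule Λ Y}
    {hAB : A ≤ B} (h : IsIrreducibleHom Λ (inclusion hAB)) {N : Submodule Λ Y} (hA : A ≤ N)
    (hN : N < B) :
    ∃ r : N →ₗ[Λ] Y, LinearMap.range r ≤ A ∧ ∀ x : N, (x : Y) ∈ A → r x = x := by
  rcases h.2.2 N (isFiniteLength_iff_isNoetherian_isArtinian.2 ⟨inferInstance, inferInstance⟩)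
    (inclusion hA) (inclusion hN.le) rfl with ⟨g, hg⟩ | ⟨g, hg⟩
  · refine ⟨A.subtype ∘ₗ g, (LinearMap.range_comp_le_range _ _).trans A.range_subtype.le,
      fun x hx => ?_⟩
    exact congrArg Subtype.val (LinearMap.congr_fun hg ⟨x, hx⟩)
  · refine absurd (fun x hx => ?_) hN.not_ge
    have : (g ⟨x, hx⟩ : Y) = x := congrArg Subtype.val (LinearMap.congr_fun hg ⟨x, hx⟩)
    exact this ▸ (g ⟨x, hx⟩).2

lemma IsMFiltration.update {m : ℕ} (hM : ∃ x : M, x ≠ 0) {c : Fin (m + 1) → Submodule Λ Y}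
    (hc : IsMFiltration Λ M c) {i : ℕ} (hi : i + 1 < m) {W : Submodule Λ Y}
    (h1 : c ⟨i, by omega⟩ ≤ W) (h2 : W ≤ c ⟨i + 2, by omega⟩)
    (hf1 : IsFactor M (c ⟨i, by omega⟩) W) (hf2 : IsFactor M W (c ⟨i + 2, by omega⟩)) :
    IsMFiltration Λ M (Function.update c ⟨i + 1, by omega⟩ W) := by
  have key : ∀ j : Fin m,
      Function.update c ⟨i + 1, by omega⟩ W j.castSucc <
        Function.update c ⟨i + 1, by omega⟩ W j.succ ∧
      IsFactor M (Function.update c ⟨i + 1, by omega⟩ W j.castSucc)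
        (Function.update c ⟨i + 1, by omega⟩ W j.succ) := by
    rintro ⟨j, hj⟩
    simp only [Fin.castSucc_mk, Fin.succ_mk]
    rcases eq_or_ne j i with rfl | hji
    · rw [Function.update_self, Function.update_of_ne (by simp)]
      exact ⟨lt_of_le_of_ne h1 (hf1.ne hM), hf1⟩
    rcases eq_or_ne j (i + 1) with rfl | hji'
    · rw [Function.update_self, Function.update_of_ne (by simp)]
      exact ⟨lt_of_le_of_ne h2 (hf2.ne hM), hf2⟩
    · rw [Function.update_of_ne (by simpa using hji'), Function.update_of_ne (by simpa using hji)]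
      exact ⟨hc.lt ⟨j, hj⟩, hc.quot ⟨j, hj⟩⟩
  refine ⟨?_, ?_, fun j => (key j).1, fun j => (key j).2⟩
  · rw [Function.update_of_ne (by simp [Fin.ext_iff]), hc.bot]
  · rw [Function.update_of_ne (by simp [Fin.ext_iff]; omega), hc.top]

lemma IsHomogMFiltration.uniqueTower [IsNoetherian Λ Y] [IsArtinian Λ Y] {m : ℕ}
    (hM : ∃ x : M, x ≠ 0) {c : Fin (m + 1) → Submodule Λ Y} (hc : IsHomogMFiltration Λ M c)
    (huniq : ∀ c' : Fin (m + 1) → Submodule Λ Y, IsMFiltration Λ M c' → c' = c) :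
    UniqueTower M (fun j => if h : j < m + 1 then c ⟨j, h⟩ else ⊤) m where
  bot := (dif_pos _).trans hc.bot
  top := (dif_pos _).trans hc.top
  le i hi := by
    rw [dif_pos (by omega), dif_pos (by omega)]
    exact (hc.lt ⟨i, hi⟩).le
  factor i hi := by
    rw [dif_pos (by omega), dif_pos (by omega)]
    exact hc.quot ⟨i, hi⟩
  indec i hi hi0 := by
    rw [dif_pos (by omega)]
    exact hc.indec _ (by simpa [Fin.ext_iff] using hi0)
  retract i hi hi0 N := by
    rw [dif_pos (by omega), dif_pos (by omega)]
    exact fun hA hN => (hc.irr ⟨i, hi⟩ hi0).exists_retract hA hN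
  unique i hi W := by
    rw [dif_pos (by omega), dif_pos (by omega), dif_pos (by omega)]
    intro h1 h2 hf1 hf2
    rw [← huniq _ (hc.toIsMFiltration.update hM hi h1 h2 hf1 hf2), Function.update_self]

end HomogeneousFiltration

/-- Let `M` be an indecomposable brick and `Y` a module with a
homogeneous `M`-filtration `M = M[1] ⊂ ⋯ ⊂ M[m] = Y` which is the only `M`-filtration
of `Y`, and assume `m ≥ 2`. Then `Y` has precisely one Gabriel-Roiter submodule,
namely `M[m−1]`. -/
theorem gabriel_roiter_stmt17
    (k : Type u) [CommRing k] [IsArtinianRing k]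
    (Λ : Type u) [Ring Λ] [Algebra k Λ] [Module.Finite k Λ]
    (M : Type v) [AddCommGroup M] [Module Λ M] (hMfl : IsFiniteLength Λ M)
    (hMind : IndecMod Λ M) (hMbrick : IsBrick Λ M)
    (Y : Type v) [AddCommGroup Y] [Module Λ Y] (hYfl : IsFiniteLength Λ Y)
    (m : ℕ) (hm : 2 ≤ m)
    (c : Fin (m + 1) → Submodule Λ Y) (hc : IsHomogMFiltration Λ M c)
    (huniq : ∀ (m' : ℕ) (c' : Fin (m' + 1) → Submodule Λ Y), IsMFiltration Λ M c' →
      ∃ h : m' = m, ∀ i : Fin (m' + 1), c' i = c (Fin.cast (by rw [h]) i)) :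
    ∀ X : Submodule Λ Y, IsGRSub Λ X ↔ X = c ⟨m - 1, by omega⟩ := by
  obtain ⟨_, _⟩ := isFiniteLength_iff_isNoetherian_isArtinian.1 hMfl
  obtain ⟨_, _⟩ := isFiniteLength_iff_isNoetherian_isArtinian.1 hYfl
  have T := hc.uniqueTower hMbrick.1 fun c' hc' => funext (huniq m c' hc').2
  intro X
  rw [T.isGRSub_iff hMind hMbrick hm, dif_pos (by omega)]
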